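/- Let (G, P, L) be a minimum counterexample to the following statement, minimizing |V(G)| + |E(G)|: 'Every triangle-free plane graph G with outer face F, subpath P ⊆ F with at most two vertices, and (*,1)-list assignment L satisfying conditions (i)–(v) is L-colorable.' Then the cycle bounding the outer face F of G has no chord. -/

import Mathlib

open Set

namespace ChoosSep

/-- `G` has a cycle of length `n`. -/
def HasCycleLen {V : Type} (G : SimpleGraph V) (n : ℕ) : Prop :=
  ∃ (v : V) (c : G.Walk v v), c.IsCycle ∧ c.length = n

/-- `G` has a proper coloring choosing each color from the list `L v`. -/
def ColorableWith {V : Type} (G : SimpleGraph V) (L : V → Finset ℕ) : Prop :=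
  ∃ φ : V → ℕ, (∀ v, φ v ∈ L v) ∧ ∀ ⦃u v⦄, G.Adj u v → φ u ≠ φ v

/-- `G` is `(k,d)`-choosable: it has an `L`-coloring for every list assignment
giving each vertex at least `k` colors and any two adjacent vertices at most `d`
common colors. -/
def Choosable {V : Type} (G : SimpleGraph V) (k d : ℕ) : Prop :=
  ∀ L : V → Finset ℕ, (∀ v, k ≤ (L v).card) →
    (∀ ⦃u v⦄, G.Adj u v → ((L u) ∩ (L v)).card ≤ d) →
    ColorableWith G L

/-- The closed straight segment between two points of the plane. -/
def seg (x y : ℝ × ℝ) : Set (ℝ × ℝ) := segment ℝ x y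

/-- A straight-line plane embedding of `G`: vertices go to distinct points, edges are
drawn as straight segments, two distinct edges meet only in common endpoints, and no
vertex lies on the drawing of an edge it does not belong to.  By Fáry's theorem a
finite simple graph admits such an embedding iff it is planar. -/
structure PlaneEmb {V : Type} (G : SimpleGraph V) where
  pos : V → ℝ × ℝ
  inj : Function.Injective pos
  edges_meet : ∀ ⦃a b c d : V⦄, G.Adj a b → G.Adj c d → s(a, b) ≠ s(c, d) →
    seg (pos a) (pos b) ∩ seg (pos c) (pos d) ⊆ ({pos a, pos b} ∩ {pos c, pos d} : Set (ℝ × ℝ))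
  vertex_off : ∀ ⦃a b v : V⦄, G.Adj a b → v ≠ a → v ≠ b → pos v ∉ seg (pos a) (pos b)

/-- `G` is planar: it admits a plane embedding. -/
def IsPlanar {V : Type} (G : SimpleGraph V) : Prop := Nonempty (PlaneEmb G)

variable {V : Type} {G : SimpleGraph V}

/-- The drawing of the graph in the plane: all vertex points and all edge segments. -/
def PlaneEmb.drawing (E : PlaneEmb G) : Set (ℝ × ℝ) :=
  Set.range E.pos ∪ ⋃ (a : V) (b : V) (_ : G.Adj a b), seg (E.pos a) (E.pos b)

/-- A face of the embedding: a connected component of the complement of the drawing. -/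
def PlaneEmb.IsFace (E : PlaneEmb G) (C : Set (ℝ × ℝ)) : Prop :=
  ∃ q, q ∉ E.drawing ∧ C = connectedComponentIn E.drawingᶜ q

/-- The outer face: the unbounded face. -/
def PlaneEmb.IsOuterFace (E : PlaneEmb G) (C : Set (ℝ × ℝ)) : Prop :=
  E.IsFace C ∧ ¬ Bornology.IsBounded C

/-- The vertices lying on the boundary of the face `C`. -/
def PlaneEmb.onFace (E : PlaneEmb G) (C : Set (ℝ × ℝ)) : Set V :=
  {v | E.pos v ∈ closure C}

/-- An edge of `G` lying on the boundary of the face `C`. -/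
def PlaneEmb.BoundaryEdge (E : PlaneEmb G) (C : Set (ℝ × ℝ)) (u v : V) : Prop :=
  G.Adj u v ∧ seg (E.pos u) (E.pos v) ⊆ closure C

/-- `C` is a 3-face with (mutually adjacent) incident vertices `x`, `y`, `z`. -/
def PlaneEmb.IsTriFace (E : PlaneEmb G) (C : Set (ℝ × ℝ)) (x y z : V) : Prop :=
  E.IsFace C ∧ G.Adj x y ∧ G.Adj y z ∧ G.Adj x z ∧
    frontier C = seg (E.pos x) (E.pos y) ∪ seg (E.pos y) (E.pos z) ∪ seg (E.pos x) (E.pos z)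

/-- `C` is a 4-face with incident 4-cycle `w x y z`. -/
def PlaneEmb.IsQuadFace (E : PlaneEmb G) (C : Set (ℝ × ℝ)) (w x y z : V) : Prop :=
  E.IsFace C ∧ G.Adj w x ∧ G.Adj x y ∧ G.Adj y z ∧ G.Adj z w ∧ w ≠ y ∧ x ≠ z ∧
    frontier C = seg (E.pos w) (E.pos x) ∪ seg (E.pos x) (E.pos y) ∪
      seg (E.pos y) (E.pos z) ∪ seg (E.pos z) (E.pos w)

/-- `x z1 y z2` is a diamond: a 4-cycle formed by two adjacent 3-faces
`x y z1` and `x y z2` sharing the edge `x y`. -/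
def PlaneEmb.IsDiamond (E : PlaneEmb G) (x z1 y z2 : V) : Prop :=
  z1 ≠ z2 ∧ ∃ C1 C2 : Set (ℝ × ℝ), C1 ≠ C2 ∧ E.IsTriFace C1 x y z1 ∧ E.IsTriFace C2 x y z2

/-- The union of the three sides of the triangle `a b c`. -/
def triBoundary (a b c : ℝ × ℝ) : Set (ℝ × ℝ) := seg a b ∪ seg b c ∪ seg a c

/-- The open interior region of the triangle `a b c`: points off the triangle whose
connected component in the complement of the triangle is bounded. -/
def triInterior (a b c : ℝ × ℝ) : Set (ℝ × ℝ) :=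
  {p | p ∉ triBoundary a b c ∧
    Bornology.IsBounded (connectedComponentIn (triBoundary a b c)ᶜ p)}

/-- The degree of a vertex. -/
noncomputable def deg (G : SimpleGraph V) (v : V) : ℕ := Nat.card {u : V // G.Adj v u}

/-- `G` is 2-connected: connected and with no cutvertex. -/
def TwoConnected (G : SimpleGraph V) : Prop :=
  G.Connected ∧ ∀ v : V, (G.induce {u : V | u ≠ v}).Connected

/-- A configuration for Theorem 5: a triangle-free plane graph with outer face `F`,
a precolored subpath `P` of the outer face with at most two vertices, and a
`(*,1)`-list assignment `L` satisfying conditions (i)–(v). -/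
structure Cfg3 where
  n : ℕ
  G : SimpleGraph (Fin n)
  E : PlaneEmb G
  F : Set (ℝ × ℝ)
  P : List (Fin n)
  L : Fin n → Finset ℕ

namespace Cfg3

/-- All hypotheses of Theorem 5 hold for the configuration. -/
def Valid (C : Cfg3) : Prop :=
  (¬ HasCycleLen C.G 3) ∧
  C.E.IsOuterFace C.F ∧
  C.P.Nodup ∧ C.P.length ≤ 2 ∧
  (∀ v ∈ C.P, v ∈ C.E.onFace C.F) ∧
  C.P.Chain' (C.E.BoundaryEdge C.F) ∧
  (∀ v, 1 ≤ (C.L v).card) ∧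
  (∀ ⦃u v⦄, C.G.Adj u v → ((C.L u) ∩ (C.L v)).card ≤ 1) ∧
  (∀ v, v ∉ C.E.onFace C.F → 3 ≤ (C.L v).card) ∧
  (∀ v ∈ C.E.onFace C.F, v ∉ C.P → 2 ≤ (C.L v).card) ∧
  (∀ v ∈ C.P, (C.L v).card = 1) ∧
  (∀ ⦃u v⦄, C.G.Adj u v → (C.L u).card = 2 → (C.L v).card ≠ 2) ∧
  (∃ φ : Fin C.n → ℕ, (∀ v ∈ C.P, φ v ∈ C.L v) ∧
    ∀ ⦃u v⦄, u ∈ C.P → v ∈ C.P → C.G.Adj u v → φ u ≠ φ v)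

/-- The configuration admits an `L`-coloring. -/
def Colorable (C : Cfg3) : Prop := ColorableWith C.G C.L

/-- The quantity `|V(G)| + |E(G)|`. -/
noncomputable def measure (C : Cfg3) : ℕ := C.n + Nat.card ↥C.G.edgeSet

/-- `C` is a minimum counterexample to Theorem 5: it satisfies the hypotheses, has no
`L`-coloring, and minimizes `|V(G)| + |E(G)|` among all such counterexamples. -/
def MinCounterexample (C : Cfg3) : Prop :=
  C.Valid ∧ ¬ C.Colorable ∧
    ∀ D : Cfg3, D.Valid → ¬ D.Colorable → C.measure ≤ D.measure

/-- `uv` is a chord of the outer cycle: an edge between two vertices of the outer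
face that is not an edge of the outer face. -/
def IsChord (C : Cfg3) (u v : Fin C.n) : Prop :=
  C.G.Adj u v ∧ u ∈ C.E.onFace C.F ∧ v ∈ C.E.onFace C.F ∧ ¬ C.E.BoundaryEdge C.F u v

/-- `v0 v1 v2` is a 2-chord of the outer cycle. -/
def Is2Chord (C : Cfg3) (v0 v1 v2 : Fin C.n) : Prop :=
  C.G.Adj v0 v1 ∧ C.G.Adj v1 v2 ∧ v0 ≠ v2 ∧
    v0 ∈ C.E.onFace C.F ∧ v2 ∈ C.E.onFace C.F ∧ v1 ∉ C.E.onFace C.F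

/-- A 2-chord `v0 v1 v2` is bad if `v0` or `v2` is an `L2`-vertex. -/
def IsBad2Chord (C : Cfg3) (v0 v1 v2 : Fin C.n) : Prop :=
  C.Is2Chord v0 v1 v2 ∧ ((C.L v0).card = 2 ∨ (C.L v2).card = 2)

/-- An `L3`-vertex of the outer face is good if it lies on no bad 2-chord. -/
def IsGoodVertex (C : Cfg3) (x : Fin C.n) : Prop :=
  x ∈ C.E.onFace C.F ∧ (C.L x).card = 3 ∧
    ¬ ∃ v0 v1 v2, C.IsBad2Chord v0 v1 v2 ∧ (x = v0 ∨ x = v1 ∨ x = v2)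

end Cfg3

/-- The identification of `ℝ × ℝ` with the complex plane. -/
noncomputable def toComplex : (ℝ × ℝ) ≃L[ℝ] ℂ := Complex.equivRealProdCLM.symm

theorem mem_seg_iff {u v z : ℝ × ℝ} :
    z ∈ seg u v ↔ ∃ t : ℝ, 0 ≤ t ∧ t ≤ 1 ∧
      toComplex z = toComplex u + t * (toComplex v - toComplex u) := by
  unfold seg
  rw [segment_eq_image']
  constructor
  · rintro ⟨t, ⟨h0, h1⟩, rfl⟩
    exact ⟨t, h0, h1, by simp⟩
  · rintro ⟨t, h0, h1, h⟩
    refine ⟨t, ⟨h0, h1⟩, toComplex.injective ?_⟩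
    simp [h]

theorem isClosed_seg (u v : ℝ × ℝ) : IsClosed (seg u v) := by
  unfold seg
  rw [segment_eq_image']
  exact (isCompact_Icc.image (by fun_prop)).isClosed

theorem isPreconnected_compl_seg {u v : ℝ × ℝ} (huv : u ≠ v) : IsPreconnected (seg u v)ᶜ := by
  have hd : toComplex v - toComplex u ≠ 0 :=
    sub_ne_zero.mpr fun h => huv (toComplex.injective h).symm
  have key : IsPreconnected {w : ℂ | -w ∈ Complex.slitPlane ∨ w - 1 ∈ Complex.slitPlane} := by
    have hs : IsPreconnected Complex.slitPlane :=
      (Complex.starConvex_one_slitPlane.isPathConnected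
        Complex.one_mem_slitPlane).isConnected.isPreconnected
    have h1 : IsPreconnected ((fun w : ℂ => -w) '' Complex.slitPlane) :=
      hs.image _ (by fun_prop)
    have h2 : IsPreconnected ((fun w : ℂ => w + 1) '' Complex.slitPlane) :=
      hs.image _ (by fun_prop)
    have hI : Complex.I ∈ (fun w : ℂ => -w) '' Complex.slitPlane :=
      ⟨-Complex.I, by simp [Complex.mem_slitPlane_iff], by simp⟩
    have hI' : Complex.I ∈ (fun w : ℂ => w + 1) '' Complex.slitPlane :=
      ⟨Complex.I - 1, by simp [Complex.mem_slitPlane_iff], by simp⟩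
    convert h1.union _ hI hI' h2 using 1
    ext w
    simp only [mem_ofPred_eq, mem_union, mem_image]
    refine or_congr ⟨fun h => ⟨-w, h, neg_neg w⟩, ?_⟩ ⟨fun h => ⟨w - 1, h, by ring⟩, ?_⟩
    · rintro ⟨x, hx, rfl⟩
      simpa using hx
    · rintro ⟨x, hx, rfl⟩
      simpa using hx
  convert key.image (fun w => toComplex.symm (toComplex u + w * (toComplex v - toComplex u)))
    (by fun_prop) using 1
  ext z
  simp only [mem_compl_iff, mem_image, mem_ofPred_eq, mem_seg_iff]
  constructor
  · intro h
    refine ⟨(toComplex z - toComplex u) / (toComplex v - toComplex u), ?_, ?_⟩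
    · by_contra hw
      set w := (toComplex z - toComplex u) / (toComplex v - toComplex u) with hwdef
      simp only [Complex.mem_slitPlane_iff, not_or, not_lt, not_not, Complex.neg_re,
        Complex.neg_im, Complex.sub_re, Complex.one_re, neg_eq_zero] at hw
      refine h ⟨w.re, by linarith [hw.1.1], by linarith [hw.2.1], ?_⟩
      have : (w.re : ℂ) = w := Complex.ext (by simp) (by simp [hw.1.2])
      rw [this, hwdef, div_mul_cancel₀ _ hd]
      ring
    · rw [div_mul_cancel₀ _ hd]
      simp
  · rintro ⟨w, hw, rfl⟩ ⟨t, h0, h1, h⟩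
    have : w = t := by
      simpa [hd] using h
    subst this
    simp only [Complex.mem_slitPlane_iff, Complex.neg_re, Complex.neg_im, Complex.sub_re,
      Complex.ofReal_re, Complex.ofReal_im, Complex.one_re, Complex.sub_im, Complex.one_im] at hw
    rcases hw with (h | h) | (h | h)
    · linarith
    · simp at h
    · linarith
    · simp at h

/-- The angle at which the segment from `x` to `y` is seen from `z`. -/
noncomputable def viewAngle (x y z : ℝ × ℝ) : ℝ :=
  ((toComplex z - toComplex x) / (toComplex z - toComplex y)).arg

theorem sub_ne_zero_of_notMem_seg {x y z : ℝ × ℝ} (hz : z ∉ seg x y) :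
    toComplex z - toComplex y ≠ 0 :=
  sub_ne_zero.mpr fun h => hz (toComplex.injective h ▸ right_mem_segment ℝ x y)

theorem div_mem_slitPlane {x y z : ℝ × ℝ} (hz : z ∉ seg x y) :
    (toComplex z - toComplex x) / (toComplex z - toComplex y) ∈ Complex.slitPlane := by
  have hy := sub_ne_zero_of_notMem_seg hz
  by_contra h
  set w := (toComplex z - toComplex x) / (toComplex z - toComplex y) with hw
  simp only [Complex.mem_slitPlane_iff, not_or, not_lt, not_not] at h
  have hwr : ((w.re : ℝ) : ℂ) = w := Complex.ext (by simp) (by simp [h.2])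
  have hpos : 0 < 1 - w.re := by linarith [h.1]
  have heq : toComplex z - toComplex x = w.re * (toComplex z - toComplex y) := by
    rw [hwr, hw, div_mul_cancel₀ _ hy]
  refine hz (mem_seg_iff.mpr ⟨-w.re / (1 - w.re), div_nonneg (by linarith [h.1]) hpos.le, ?_, ?_⟩)
  · rw [div_le_one hpos]; linarith
  · have hne : (1 - (w.re : ℂ)) ≠ 0 := by exact_mod_cast hpos.ne'
    push_cast
    field_simp
    linear_combination heq

theorem continuousOn_viewAngle (x y : ℝ × ℝ) : ContinuousOn (viewAngle x y) (seg x y)ᶜ := by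
  intro z hz
  have hy := sub_ne_zero_of_notMem_seg hz
  refine ContinuousAt.continuousWithinAt ?_
  unfold viewAngle
  exact ContinuousAt.comp (f := fun z => (toComplex z - toComplex x) / (toComplex z - toComplex y))
    (Complex.continuousAt_arg (div_mem_slitPlane hz))
    (ContinuousAt.div (by fun_prop) (by fun_prop) hy)

/-- `g` measures, up to multiples of `2π`, the angle of the pair `x`, `y` seen from `z`. -/
def IsAngleAt (x y : ℝ × ℝ) (g : ℝ × ℝ → ℝ) (z : ℝ × ℝ) : Prop :=
  ∃ r : ℝ, 0 < r ∧ toComplex z - toComplex x =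
    r * Complex.exp (g z * Complex.I) * (toComplex z - toComplex y)

theorem isAngleAt_viewAngle {x y z : ℝ × ℝ} (hz : z ∉ seg x y) :
    IsAngleAt x y (viewAngle x y) z := by
  have hy := sub_ne_zero_of_notMem_seg hz
  refine ⟨‖(toComplex z - toComplex x) / (toComplex z - toComplex y)‖,
    norm_pos_iff.mpr (Complex.slitPlane_ne_zero (div_mem_slitPlane hz)), ?_⟩
  unfold viewAngle
  rw [Complex.norm_mul_exp_arg_mul_I, div_mul_cancel₀ _ hy]

theorem IsAngleAt.trans {x y w z : ℝ × ℝ} {g h : ℝ × ℝ → ℝ} (hg : IsAngleAt x y g z)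
    (hh : IsAngleAt y w h z) : IsAngleAt x w (g + h) z := by
  obtain ⟨r, hr, hg⟩ := hg
  obtain ⟨s, hs, hh⟩ := hh
  refine ⟨r * s, mul_pos hr hs, ?_⟩
  rw [hg, hh]
  simp only [Pi.add_apply, Complex.ofReal_add, add_mul, Complex.exp_add, Complex.ofReal_mul]
  ring

theorem IsAngleAt.exists_sub_eq {x y z : ℝ × ℝ} {g h : ℝ × ℝ → ℝ} (hg : IsAngleAt x y g z)
    (hh : IsAngleAt x y h z) (hz : z ≠ y) : ∃ n : ℤ, g z - h z = n * (2 * Real.pi) := by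
  obtain ⟨r, hr, hg⟩ := hg
  obtain ⟨s, hs, hh⟩ := hh
  have hy : toComplex z - toComplex y ≠ 0 :=
    sub_ne_zero.mpr fun h => hz (toComplex.injective h)
  have heq : (r : ℂ) * Complex.exp (g z * Complex.I) = s * Complex.exp (h z * Complex.I) :=
    mul_right_cancel₀ hy (hg.symm.trans hh)
  have hrs : r = s := by
    simpa [Complex.norm_exp_ofReal_mul_I, abs_of_pos hr, abs_of_pos hs] using
      congrArg norm heq
  subst hrs
  have hexp := mul_left_cancel₀ (by exact_mod_cast hr.ne') heq
  obtain ⟨n, hn⟩ := Complex.exp_eq_exp_iff_exists_int.mp hexp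
  refine ⟨n, ?_⟩
  have := congrArg Complex.im hn
  simp at this
  linarith

/-- There is a continuous choice of the angle of `x`, `y` away from some closed subset of `T`. -/
def AngleRel (T : Set (ℝ × ℝ)) (x y : ℝ × ℝ) : Prop :=
  ∃ S : Set (ℝ × ℝ), IsClosed S ∧ S ⊆ T ∧
    ∃ g : ℝ × ℝ → ℝ, ContinuousOn g Sᶜ ∧ ∀ z ∉ S, IsAngleAt x y g z

theorem AngleRel.of_seg {T : Set (ℝ × ℝ)} {x y : ℝ × ℝ} (h : seg x y ⊆ T) : AngleRel T x y :=
  ⟨seg x y, isClosed_seg x y, h, viewAngle x y, continuousOn_viewAngle x y,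
    fun _ hz => isAngleAt_viewAngle hz⟩

theorem AngleRel.trans {T : Set (ℝ × ℝ)} {x y z : ℝ × ℝ} (h : AngleRel T x y)
    (h' : AngleRel T y z) : AngleRel T x z := by
  obtain ⟨S, hS, hST, g, hg, hga⟩ := h
  obtain ⟨S', hS', hST', g', hg', hga'⟩ := h'
  refine ⟨S ∪ S', hS.union hS', union_subset hST hST', g + g', ?_, fun z hz => ?_⟩
  · exact (hg.mono (compl_subset_compl.mpr subset_union_left)).add
      (hg'.mono (compl_subset_compl.mpr subset_union_right))
  · exact (hga z fun h => hz (Or.inl h)).trans (hga' z fun h => hz (Or.inr h))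

theorem AngleRel.of_isPreconnected {T F : Set (ℝ × ℝ)} (hF : IsPreconnected F) (ho : IsOpen F)
    (hFT : F ⊆ T) {x y : ℝ × ℝ} (hx : x ∈ F) (hy : y ∈ F) : AngleRel T x y := by
  refine hF.induction₂' (AngleRel T) (fun x hx => ?_)
    (fun _ _ _ _ _ _ h h' => h.trans h') hx hy
  obtain ⟨ε, hε, hb⟩ := Metric.isOpen_iff.mp ho x hx
  refine Filter.Eventually.filter_mono nhdsWithin_le_nhds ?_
  filter_upwards [Metric.ball_mem_nhds x hε] with y hy
  have hsub := (convex_ball x ε).segment_subset (Metric.mem_ball_self hε) hy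
  exact ⟨.of_seg ((hsub.trans hb).trans hFT),
    .of_seg (by unfold seg; rw [segment_symm]; exact (hsub.trans hb).trans hFT)⟩

theorem exists_sub_viewAngle_ne {u v q : ℝ × ℝ} (huv : u ≠ v) {l : ℝ} (hl0 : 0 < l) (hl1 : l < 1)
    (hq : toComplex q = toComplex u + l * (toComplex v - toComplex u)) {g : ℝ × ℝ → ℝ}
    (hg : ContinuousAt g q) (s : ℝ) {U : Set (ℝ × ℝ)} (hU : U ∈ nhds q) :
    ∃ x ∈ U, x ∉ seg u v ∧ g x - viewAngle u v x ≠ s := by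
  by_contra! hcon
  have hd : toComplex v - toComplex u ≠ 0 :=
    sub_ne_zero.mpr fun h => huv (toComplex.injective h).symm
  set z : ℝ → ℝ × ℝ := fun t =>
    toComplex.symm (toComplex u + (l + t * Complex.I) * (toComplex v - toComplex u)) with hzdef
  have hzc : Continuous z := by fun_prop
  have hz0 : z 0 = q := toComplex.injective (by simp [hzdef, hq])
  set w : ℝ → ℂ := fun t => (l + t * Complex.I) / (l - 1 + t * Complex.I) with hwdef
  have hden : ∀ t : ℝ, (l - 1 + t * Complex.I : ℂ) ≠ 0 := by
    intro t h
    have := congrArg Complex.re h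
    simp at this
    linarith
  have hwc : Continuous w := by
    refine Continuous.div (by fun_prop) (by fun_prop) hden
  have hangle : ∀ t, viewAngle u v (z t) = (w t).arg := by
    intro t
    unfold viewAngle
    have h1 : toComplex (z t) - toComplex u =
        (l + t * Complex.I) * (toComplex v - toComplex u) := by simp [hzdef]
    have h2 : toComplex (z t) - toComplex v =
        (l - 1 + t * Complex.I) * (toComplex v - toComplex u) := by
      simp [hzdef]; ring
    rw [h1, h2, mul_div_mul_right _ _ hd]
  have him : ∀ t, (w t).im = -t / ((l - 1) ^ 2 + t ^ 2) := by
    intro t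
    simp [hwdef, Complex.div_im, Complex.normSq_apply]
    ring
  have hpos : ∀ t : ℝ, 0 < (l - 1) ^ 2 + t ^ 2 := fun t => by nlinarith [sq_nonneg t]
  have hnot : ∀ t : ℝ, t ≠ 0 → z t ∉ seg u v := by
    rintro t ht h
    obtain ⟨m, -, -, hm⟩ := mem_seg_iff.mp h
    have : (l + t * Complex.I : ℂ) = m := by simpa [hzdef, hd] using hm
    have := congrArg Complex.im this
    simp at this
    exact ht this
  have hre0 : (w 0).re < 0 := by
    have : w 0 = ((l / (l - 1) : ℝ) : ℂ) := by simp [hwdef]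
    rw [this, Complex.ofReal_re]
    exact div_neg_of_pos_of_neg hl0 (by linarith)
  have him0 : (w 0).im = 0 := by simp [him]
  have hev : ∀ᶠ t in nhds (0 : ℝ), z t ∈ U := hzc.continuousAt (by rw [hz0]; exact hU)
  have hlim : Filter.Tendsto (fun t => g (z t) - s) (nhds 0) (nhds (g q - s)) := by
    have : ContinuousAt (fun t => g (z t)) 0 :=
      ContinuousAt.comp (g := g) (by rw [hz0]; exact hg) hzc.continuousAt
    have := this.tendsto.sub_const s
    rwa [hz0] at this
  have heq : ∀ᶠ t in nhds (0 : ℝ), t ≠ 0 → (w t).arg = g (z t) - s := by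
    filter_upwards [hev] with t ht h0
    have := hcon (z t) ht (hnot t h0)
    rw [hangle] at this
    linarith
  have hright : g q - s = -Real.pi := by
    refine tendsto_nhds_unique (f := fun t => g (z t) - s) (l := nhdsWithin 0 (Ioi 0))
      (hlim.mono_left nhdsWithin_le_nhds) ?_
    have h1 : Filter.Tendsto w (nhdsWithin 0 (Ioi 0)) (nhdsWithin (w 0) {z : ℂ | z.im < 0}) := by
      refine tendsto_nhdsWithin_iff.mpr
        ⟨hwc.continuousAt.tendsto.mono_left nhdsWithin_le_nhds, ?_⟩
      filter_upwards [self_mem_nhdsWithin] with t ht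
      have ht : 0 < t := ht
      change (w t).im < 0
      rw [him]
      exact div_neg_of_neg_of_pos (by linarith) (hpos t)
    refine ((Complex.tendsto_arg_nhdsWithin_im_neg_of_re_neg_of_im_zero hre0 him0).comp h1).congr' ?_
    filter_upwards [self_mem_nhdsWithin, heq.filter_mono nhdsWithin_le_nhds] with t ht h
    exact h (ne_of_gt ht)
  have hleft : g q - s = Real.pi := by
    refine tendsto_nhds_unique (f := fun t => g (z t) - s) (l := nhdsWithin 0 (Iio 0))
      (hlim.mono_left nhdsWithin_le_nhds) ?_
    have h1 : Filter.Tendsto w (nhdsWithin 0 (Iio 0)) (nhdsWithin (w 0) {z : ℂ | 0 ≤ z.im}) := by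
      refine tendsto_nhdsWithin_iff.mpr
        ⟨hwc.continuousAt.tendsto.mono_left nhdsWithin_le_nhds, ?_⟩
      filter_upwards [self_mem_nhdsWithin] with t ht
      have ht : t < 0 := ht
      change 0 ≤ (w t).im
      rw [him]
      exact div_nonneg (by linarith) (hpos t).le
    refine ((Complex.tendsto_arg_nhdsWithin_im_nonneg_of_re_neg_of_im_zero hre0 him0).comp
      h1).congr' ?_
    filter_upwards [self_mem_nhdsWithin, heq.filter_mono nhdsWithin_le_nhds] with t ht h
    exact h (ne_of_lt ht)
  linarith [Real.pi_pos]

theorem eqOn_of_isPreconnected_of_int_mul {Z : Set (ℝ × ℝ)} (hZ : IsPreconnected Z)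
    {M : ℝ × ℝ → ℝ} (hM : ContinuousOn M Z) {c : ℝ} (hc : 0 < c)
    (hint : ∀ z ∈ Z, ∃ n : ℤ, M z = n * c) {x y : ℝ × ℝ} (hx : x ∈ Z) (hy : y ∈ Z) :
    M x = M y := by
  have key : ∀ x ∈ Z, ∀ y ∈ Z, M y ≤ M x := by
    intro x hx y hy
    by_contra! hlt
    obtain ⟨m, hm⟩ := hint x hx
    obtain ⟨n, hn⟩ := hint y hy
    have hmn : m + 1 ≤ n := by
      rw [hm, hn] at hlt
      have := lt_of_mul_lt_mul_right hlt hc.le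
      exact_mod_cast this
    have hmn' : (m : ℝ) + 1 ≤ n := by exact_mod_cast hmn
    obtain ⟨z, hz, hzM⟩ := hZ.intermediate_value hx hy hM
      (show ((m : ℝ) + 1 / 2) * c ∈ Icc (M x) (M y) by
        constructor <;> nlinarith)
    obtain ⟨k, hk⟩ := hint z hz
    rw [hk] at hzM
    have hk' := mul_right_cancel₀ hc.ne' hzM
    have h2 : (2 * k : ℝ) = 2 * m + 1 := by linarith
    have h3 : 2 * k = 2 * m + 1 := by exact_mod_cast h2
    omega
  exact le_antisymm (key y hy x hx) (key x hx y hy)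

/-- If a closed set `D` containing a segment stays connected after removing the segment, and
both ends of the segment are accessible from a component of the complement of `D`, then the
segment lies on the boundary of that component. -/
theorem seg_subset_closure_of_accessible {u v : ℝ × ℝ} (huv : u ≠ v) {D F : Set (ℝ × ℝ)}
    (hD : IsClosed D) (hsegD : seg u v ⊆ D) {a : ℝ × ℝ}
    (hF : F = connectedComponentIn Dᶜ a) {b c : ℝ × ℝ} (hb : b ∈ F) (hc : c ∈ F)
    (hub : seg u b \ {u} ⊆ F) (hvc : seg v c \ {v} ⊆ F)
    (hconn : ∀ M : ℝ × ℝ → ℝ, (∀ Z ⊆ D \ seg u v, IsPreconnected Z →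
      ∀ x ∈ Z, ∀ y ∈ Z, M x = M y) → ∃ s, ∀ x ∈ D \ seg u v, M x = s) :
    seg u v ⊆ closure F := by
  have hFo : IsOpen F := hF ▸ hD.isOpen_compl.connectedComponentIn
  have hFp : IsPreconnected F := hF ▸ isPreconnected_connectedComponentIn
  have hFD : F ⊆ Dᶜ := hF ▸ connectedComponentIn_subset _ _
  have hmax : ∀ W ⊆ Dᶜ, IsPreconnected W → (W ∩ F).Nonempty → W ⊆ F := by
    rintro W hWD hW ⟨y, hyW, hyF⟩
    rw [hF] at hyF ⊢
    rw [connectedComponentIn_eq hyF]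
    exact hW.subset_connectedComponentIn hyW hWD
  obtain ⟨S, hS, hST, g, hg, hga⟩ : AngleRel (F ∪ {u, v}) u v := by
    refine (AngleRel.of_seg (y := b) fun x hx => ?_).trans
      ((AngleRel.of_isPreconnected hFp hFo subset_union_left hb hc).trans
        (AngleRel.of_seg fun x hx => ?_))
    · by_cases h : x = u
      · simp [h]
      · exact Or.inl (hub ⟨hx, h⟩)
    · by_cases h : x = v
      · simp [h]
      · refine Or.inl (hvc ⟨?_, h⟩)
        unfold seg at hx ⊢
        rwa [segment_symm]
  have hu : u ∈ seg u v := left_mem_segment ℝ u v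
  have hv : v ∈ seg u v := right_mem_segment ℝ u v
  have hSD : ∀ x ∈ D, x ∉ seg u v → x ∉ S := by
    intro x hx hxs hxS
    rcases hST hxS with h | h | h
    · exact hFD h hx
    · exact hxs (h ▸ hu)
    · exact hxs (h ▸ hv)
  set M : ℝ × ℝ → ℝ := fun z => g z - viewAngle u v z with hMdef
  have hMc : ContinuousOn M (S ∪ seg u v)ᶜ :=
    (hg.mono (compl_subset_compl.mpr subset_union_left)).sub
      ((continuousOn_viewAngle u v).mono (compl_subset_compl.mpr subset_union_right))
  have hMint : ∀ z ∈ (S ∪ seg u v)ᶜ, ∃ n : ℤ, M z = n * (2 * Real.pi) := by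
    intro z hz
    simp only [mem_compl_iff, mem_union, not_or] at hz
    exact (hga z hz.1).exists_sub_eq (isAngleAt_viewAngle hz.2) fun h => hz.2 (h ▸ hv)
  have hMconst : ∀ Z ⊆ (S ∪ seg u v)ᶜ, IsPreconnected Z → ∀ x ∈ Z, ∀ y ∈ Z, M x = M y :=
    fun Z hZ hZp x hx y hy => eqOn_of_isPreconnected_of_int_mul hZp (hMc.mono hZ)
      (by positivity) (fun z hz => hMint z (hZ hz)) hx hy
  obtain ⟨s, hs⟩ := hconn M fun Z hZ => hMconst Z fun x hx => by
    rintro (h | h)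
    · exact hSD x (hZ hx).1 (hZ hx).2 h
    · exact (hZ hx).2 h
  have hmem : ∀ x, x ∉ S → x ∉ seg u v → M x ≠ s → x ∈ F := by
    intro x hxS hxe hxs
    set W := connectedComponentIn (S ∪ seg u v)ᶜ x with hW
    have hxc : x ∈ (S ∪ seg u v)ᶜ := by simp [hxS, hxe]
    have hxW : x ∈ W := mem_connectedComponentIn hxc
    have hWsub : W ⊆ (S ∪ seg u v)ᶜ := connectedComponentIn_subset _ _
    have hWp : IsPreconnected W := isPreconnected_connectedComponentIn
    have hWo : IsOpen W :=
      (hS.union (isClosed_seg u v)).isOpen_compl.connectedComponentIn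
    have hWD : W ⊆ Dᶜ := by
      intro y hy hyD
      refine hxs ((hMconst W hWsub hWp x hxW y hy).trans (hs y ⟨hyD, fun h => ?_⟩))
      exact hWsub hy (Or.inr h)
    refine hmax W hWD hWp ?_ hxW
    by_contra hne
    have hcl : ∀ y ∈ closure W, y ∉ seg u v → y ∈ W := by
      intro y hy hys
      by_cases hyS : y ∈ S
      · exfalso
        rcases hST hyS with h | h | h
        · obtain ⟨t, ht⟩ := mem_closure_iff.mp hy F hFo h
          exact hne ⟨t, ht.2, ht.1⟩
        · exact hys (h ▸ hu)
        · exact hys (h ▸ hv)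
      · have hp : IsPreconnected (insert y W) :=
          hWp.subset_closure (subset_insert _ _) (insert_subset hy subset_closure)
        refine hp.subset_connectedComponentIn (mem_insert_of_mem _ hxW) ?_ (mem_insert _ _)
        exact insert_subset (by simp [hyS, hys]) hWsub
    have hall : (seg u v)ᶜ ⊆ W := by
      refine (isPreconnected_compl_seg huv).subset_left_of_subset_union hWo
        isClosed_closure.isOpen_compl (disjoint_compl_right.mono_left subset_closure) ?_
        ⟨x, hxe, hxW⟩
      intro y hy
      by_cases h : y ∈ closure W
      · exact Or.inl (hcl y h hy)
      · exact Or.inr h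
    exact hne ⟨b, hall fun h => hFD hb (hsegD h), hb⟩
  have hopen : openSegment ℝ u v ⊆ closure F := by
    intro q hq
    rw [openSegment_eq_image'] at hq
    obtain ⟨l, ⟨hl0, hl1⟩, hlq⟩ := hq
    have hq' : toComplex q = toComplex u + l * (toComplex v - toComplex u) := by
      simp [← hlq]
    have hqs : q ∈ seg u v := mem_seg_iff.mpr ⟨l, hl0.le, hl1.le, hq'⟩
    have hd : toComplex v - toComplex u ≠ 0 :=
      sub_ne_zero.mpr fun h => huv (toComplex.injective h).symm
    have hqS : q ∉ S := by
      intro h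
      rcases hST h with h | h | h
      · exact hFD h (hsegD hqs)
      · rw [h] at hq'
        have : l = 0 := by simpa [hd] using hq'
        linarith
      · rw [h] at hq'
        have : ((l : ℂ) - 1) * (toComplex v - toComplex u) = 0 := by linear_combination -hq'
        have : (l : ℂ) - 1 = 0 := (mul_eq_zero.mp this).resolve_right hd
        have : l = 1 := by exact_mod_cast sub_eq_zero.mp this
        linarith
    rw [mem_closure_iff]
    intro O hO hqO
    obtain ⟨x, hx, hxs, hxM⟩ := exists_sub_viewAngle_ne huv hl0 hl1 hq'
      (hg.continuousAt (hS.isOpen_compl.mem_nhds hqS)) s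
      (Filter.inter_mem (hO.mem_nhds hqO) (hS.isOpen_compl.mem_nhds hqS))
    exact ⟨x, hx.1, hmem x hx.2 hxs hxM⟩
  unfold seg
  rw [← closure_openSegment]
  exact closure_minimal hopen isClosed_closure

theorem seg_comm (x y : ℝ × ℝ) : seg x y = seg y x := segment_symm ℝ x y

theorem PlaneEmb.seg_subset_drawing (E : PlaneEmb G) {a b : V} (h : G.Adj a b) :
    seg (E.pos a) (E.pos b) ⊆ E.drawing := fun _ hx =>
  Or.inr (mem_iUnion.mpr ⟨a, mem_iUnion.mpr ⟨b, mem_iUnion.mpr ⟨h, hx⟩⟩⟩)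

theorem PlaneEmb.pos_mem_drawing (E : PlaneEmb G) (a : V) : E.pos a ∈ E.drawing :=
  Or.inl ⟨a, rfl⟩

theorem PlaneEmb.isClosed_drawing [Finite V] (E : PlaneEmb G) : IsClosed E.drawing :=
  (finite_range E.pos).isClosed.union <| isClosed_iUnion_of_finite fun _ =>
    isClosed_iUnion_of_finite fun _ => isClosed_iUnion_of_finite fun _ => isClosed_seg _ _

/-- Every vertex has a neighbourhood meeting the drawing only in edges at that vertex. -/
theorem PlaneEmb.exists_ball [Finite V] (E : PlaneEmb G) (u : V) :
    ∃ r > 0, (∀ v, v ≠ u → E.pos v ∉ Metric.ball (E.pos u) r) ∧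
      ∀ a b, G.Adj a b → a ≠ u → b ≠ u →
        Disjoint (seg (E.pos a) (E.pos b)) (Metric.ball (E.pos u) r) := by
  set K : Set (ℝ × ℝ) := E.pos '' {v | v ≠ u} ∪
    ⋃ (a : V) (b : V) (_ : G.Adj a b ∧ a ≠ u ∧ b ≠ u), seg (E.pos a) (E.pos b) with hK
  have hKc : IsClosed K :=
    (toFinite (E.pos '' {v | v ≠ u})).isClosed.union <| isClosed_iUnion_of_finite fun _ =>
      isClosed_iUnion_of_finite fun _ => isClosed_iUnion_of_finite fun _ => isClosed_seg _ _
  have hu : E.pos u ∉ K := by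
    rintro (⟨v, hv, h⟩ | h)
    · exact hv (E.inj h)
    · simp only [mem_iUnion] at h
      obtain ⟨a, b, ⟨hab, ha, hb⟩, h⟩ := h
      exact E.vertex_off hab ha.symm hb.symm h
  obtain ⟨r, hr, hb⟩ := Metric.isOpen_iff.mp hKc.isOpen_compl _ hu
  refine ⟨r, hr, fun v hv h => hb h (Or.inl ⟨v, hv, rfl⟩), fun a b hab hau hbu => ?_⟩
  rw [disjoint_left]
  intro x hx hxr
  refine hb hxr (Or.inr ?_)
  simp only [mem_iUnion]
  exact ⟨a, b, ⟨hab, hau, hbu⟩, hx⟩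

/-- A vertex on a face can be joined to a point of the face by a segment inside the face. -/
theorem PlaneEmb.exists_seg_subset [Finite V] (E : PlaneEmb G) {F : Set (ℝ × ℝ)}
    (hF : E.IsFace F) {u : V} (hu : u ∈ E.onFace F) :
    ∃ b ∈ F, seg (E.pos u) b \ {E.pos u} ⊆ F := by
  obtain ⟨q, -, hFq⟩ := hF
  obtain ⟨r, hr, hv, he⟩ := E.exists_ball u
  obtain ⟨b, hbr, hbF⟩ := mem_closure_iff.mp hu _ Metric.isOpen_ball (Metric.mem_ball_self hr)
  have hbD : b ∉ E.drawing := by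
    rw [hFq] at hbF
    exact connectedComponentIn_subset _ _ hbF
  refine ⟨b, hbF, ?_⟩
  have hbu : b ≠ E.pos u := fun h => hbD (h ▸ E.pos_mem_drawing u)
  set f : ℝ → ℝ × ℝ := fun t => E.pos u + t • (b - E.pos u) with hf
  have himg : seg (E.pos u) b \ {E.pos u} ⊆ f '' Ioc 0 1 := by
    rintro x ⟨hx, hxu⟩
    unfold seg at hx
    rw [segment_eq_image'] at hx
    obtain ⟨t, ⟨h0, h1⟩, rfl⟩ := hx
    refine ⟨t, ⟨lt_of_le_of_ne h0 ?_, h1⟩, rfl⟩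
    rintro rfl
    simp at hxu
  have hstar : ∀ t ∈ Ioc (0 : ℝ) 1, ∀ w, G.Adj u w → f t ∉ seg (E.pos u) (E.pos w) := by
    rintro t ⟨ht0, ht1⟩ w hw hmem
    unfold seg at hmem
    rw [segment_eq_image'] at hmem
    obtain ⟨s, ⟨hs0, hs1⟩, hs⟩ := hmem
    have hs' : t • (b - E.pos u) = s • (E.pos w - E.pos u) := by
      simpa [hf] using hs.symm
    have hbw : b - E.pos u = (s / t) • (E.pos w - E.pos u) := by
      rw [div_eq_inv_mul, mul_smul, ← hs', smul_smul, inv_mul_cancel₀ ht0.ne', one_smul]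
    by_cases hst : s / t ≤ 1
    · refine hbD (E.seg_subset_drawing hw ?_)
      unfold seg
      rw [segment_eq_image']
      exact ⟨s / t, ⟨by positivity, hst⟩, by simp [← hbw]⟩
    · refine hv w hw.ne' ?_
      rw [Metric.mem_ball, dist_eq_norm] at hbr ⊢
      rw [hbw, norm_smul, Real.norm_eq_abs, abs_of_nonneg (by positivity)] at hbr
      push Not at hst
      nlinarith [norm_nonneg (E.pos w - E.pos u)]
  have hball : ∀ t ∈ Ioc (0 : ℝ) 1, f t ∈ Metric.ball (E.pos u) r := by
    rintro t ⟨ht0, ht1⟩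
    refine (convex_ball (E.pos u) r).segment_subset (Metric.mem_ball_self hr) hbr ?_
    rw [segment_eq_image']
    exact ⟨t, ⟨ht0.le, ht1⟩, rfl⟩
  have hoff : f '' Ioc 0 1 ⊆ E.drawingᶜ := by
    rintro _ ⟨t, ht, rfl⟩ (⟨w, hw⟩ | h)
    · by_cases hwu : w = u
      · subst hwu
        have : t • (b - E.pos w) = 0 := by simpa [hf] using hw
        rcases smul_eq_zero.mp this with h | h
        · exact ht.1.ne' h
        · exact hbu (sub_eq_zero.mp h)
      · exact hv w hwu (hw ▸ hball t ht)
    · simp only [mem_iUnion] at h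
      obtain ⟨a, c, hac, h⟩ := h
      by_cases hau : a = u
      · subst hau
        exact hstar t ht c hac h
      by_cases hcu : c = u
      · subst hcu
        rw [seg_comm] at h
        exact hstar t ht a hac.symm h
      exact disjoint_left.mp (he a c hac hau hcu) h (hball t ht)
  have hb1 : b ∈ f '' Ioc 0 1 := ⟨1, ⟨zero_lt_one, le_rfl⟩, by simp [hf]⟩
  have hp : IsPreconnected (f '' Ioc 0 1) :=
    isPreconnected_Ioc.image _ (by fun_prop)
  refine himg.trans ?_
  rw [hFq] at hbF ⊢
  rw [connectedComponentIn_eq hbF]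
  exact hp.subset_connectedComponentIn hb1 hoff

/-- If `u v` is an edge with both ends on a face and the graph without `u` and `v` is connected,
then the edge `u v` lies on the boundary of that face. -/
theorem PlaneEmb.boundaryEdge_of_forall_eq [Finite V] (E : PlaneEmb G) {F : Set (ℝ × ℝ)}
    (hF : E.IsFace F) {u v : V} (huv : G.Adj u v) (hu : u ∈ E.onFace F) (hv : v ∈ E.onFace F)
    (hconn : ∀ N : V → ℝ, (∀ a b, a ≠ u → a ≠ v → b ≠ u → b ≠ v → G.Adj a b → N a = N b) →
      ∃ s, ∀ a, a ≠ u → a ≠ v → N a = s) :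
    E.BoundaryEdge F u v := by
  refine ⟨huv, ?_⟩
  obtain ⟨b, hb, hub⟩ := E.exists_seg_subset hF hu
  obtain ⟨c, hc, hvc⟩ := E.exists_seg_subset hF hv
  obtain ⟨q, -, hFq⟩ := hF
  refine seg_subset_closure_of_accessible (fun h => huv.ne (E.inj h)) E.isClosed_drawing
    (E.seg_subset_drawing huv) hFq hb hc hub hvc fun M hM => ?_
  have hvert : ∀ w, w ≠ u → w ≠ v → E.pos w ∉ seg (E.pos u) (E.pos v) :=
    fun w hwu hwv => E.vertex_off huv hwu hwv
  have hedge : ∀ w x y, w ≠ u → w ≠ v → G.Adj w x → y ∈ seg (E.pos w) (E.pos x) →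
      y ∉ seg (E.pos u) (E.pos v) → M y = M (E.pos w) := by
    intro w x y hwu hwv hwx hy hyuv
    have hsub : seg (E.pos w) y ⊆ seg (E.pos w) (E.pos x) :=
      (convex_segment _ _).segment_subset (left_mem_segment ℝ _ _) hy
    refine hM (seg (E.pos w) y) ?_ (convex_segment _ _).isPreconnected y
      (right_mem_segment ℝ _ _) _ (left_mem_segment ℝ _ _)
    intro z hz
    refine ⟨E.seg_subset_drawing hwx (hsub hz), fun hzuv => ?_⟩
    have hne : s(w, x) ≠ s(u, v) := by
      intro h
      rcases Sym2.eq_iff.mp h with ⟨h, -⟩ | ⟨h, -⟩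
      · exact hwu h
      · exact hwv h
    obtain ⟨h1, -⟩ := E.edges_meet hwx huv hne ⟨hsub hz, hzuv⟩
    rcases h1 with rfl | h1
    · exact hvert w hwu hwv hzuv
    · have h1 : z = E.pos x := h1
      subst h1
      obtain ⟨t, ht0, ht1, ht⟩ := mem_seg_iff.mp hy
      obtain ⟨s, hs0, hs1, hs⟩ := mem_seg_iff.mp hz
      have hd : toComplex (E.pos x) - toComplex (E.pos w) ≠ 0 :=
        sub_ne_zero.mpr fun h => hwx.ne (E.inj (toComplex.injective h)).symm
      have hst : (s * t : ℂ) = 1 := by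
        refine mul_right_cancel₀ hd ?_
        rw [ht] at hs
        linear_combination -hs
      have hst' : s * t = 1 := by exact_mod_cast hst
      have : t = 1 := by nlinarith
      have hyx : y = E.pos x := toComplex.injective (by rw [ht, this]; push_cast; ring)
      exact hyuv (hyx ▸ hzuv)
  obtain ⟨s, hs⟩ := hconn (fun w => M (E.pos w)) fun a b hau hav hbu hbv hab =>
    (hedge a b (E.pos b) hau hav hab (right_mem_segment ℝ _ _) (hvert b hbu hbv)).symm
  refine ⟨s, ?_⟩
  rintro x ⟨⟨w, rfl⟩ | hx, hxuv⟩
  · exact hs w (fun h => hxuv (h ▸ left_mem_segment ℝ _ _))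
      fun h => hxuv (h ▸ right_mem_segment ℝ _ _)
  simp only [mem_iUnion] at hx
  obtain ⟨a, b, hab, hx⟩ := hx
  by_cases ha : a ≠ u ∧ a ≠ v
  · exact (hedge a b x ha.1 ha.2 hab hx hxuv).trans (hs a ha.1 ha.2)
  by_cases hb : b ≠ u ∧ b ≠ v
  · rw [seg_comm] at hx
    exact (hedge b a x hb.1 hb.2 hab.symm hx hxuv).trans (hs b hb.1 hb.2)
  exfalso
  rw [not_and_or, not_not, not_not] at ha hb
  rcases ha with rfl | rfl <;> rcases hb with rfl | rfl
  · exact hab.ne rfl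
  · exact hxuv hx
  · exact hxuv (seg_comm _ _ ▸ hx)
  · exact hab.ne rfl

/-- The embedding of an induced subgraph. -/
def PlaneEmb.comap {W : Type} (E : PlaneEmb G) (f : W ↪ V) : PlaneEmb (G.comap f) where
  pos := fun w => E.pos (f w)
  inj := E.inj.comp f.injective
  edges_meet := fun a b c d hab hcd hne =>
    E.edges_meet hab hcd fun h => hne <| by
      rcases Sym2.eq_iff.mp h with ⟨h1, h2⟩ | ⟨h1, h2⟩
      · exact Sym2.eq_iff.mpr (Or.inl ⟨f.injective h1, f.injective h2⟩)
      · exact Sym2.eq_iff.mpr (Or.inr ⟨f.injective h1, f.injective h2⟩)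
  vertex_off := fun a b v hab ha hb =>
    E.vertex_off hab (fun h => ha (f.injective h)) fun h => hb (f.injective h)

theorem PlaneEmb.drawing_comap_subset {W : Type} (E : PlaneEmb G) (f : W ↪ V) :
    (E.comap f).drawing ⊆ E.drawing := by
  rintro x (⟨w, rfl⟩ | h)
  · exact E.pos_mem_drawing (f w)
  · simp only [mem_iUnion] at h
    obtain ⟨a, b, hab, h⟩ := h
    exact E.seg_subset_drawing hab h

theorem PlaneEmb.IsOuterFace.exists_comap {W : Type} {E : PlaneEmb G} {F : Set (ℝ × ℝ)}
    (hF : E.IsOuterFace F) (f : W ↪ V) :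
    ∃ F', (E.comap f).IsOuterFace F' ∧ F ⊆ F' := by
  obtain ⟨⟨q, hq, rfl⟩, hb⟩ := hF
  have hsub : connectedComponentIn E.drawingᶜ q ⊆
      connectedComponentIn (E.comap f).drawingᶜ q :=
    connectedComponentIn_mono q (compl_subset_compl.mpr (E.drawing_comap_subset f))
  exact ⟨_, ⟨⟨q, fun h => hq (E.drawing_comap_subset f h), rfl⟩, fun h => hb (h.subset hsub)⟩, hsub⟩

theorem HasCycleLen.of_comap {W : Type} {f : W ↪ V} {n : ℕ}
    (h : HasCycleLen (G.comap f) n) : HasCycleLen G n := by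
  obtain ⟨v, c, hc, hn⟩ := h
  exact ⟨f v, c.map (SimpleGraph.Embedding.comap f G).toHom,
    hc.map f.injective, (SimpleGraph.Walk.length_map _ _).trans hn⟩

theorem exists_embedding_range_eq {n : ℕ} {A : Set (Fin n)} {x : Fin n} (hx : x ∉ A) :
    ∃ (m : ℕ) (f : Fin m ↪ Fin n), m < n ∧ range f = A := by
  refine ⟨Nat.card A, (Finite.equivFin A).symm.toEmbedding.trans (Function.Embedding.subtype _),
    ?_, ?_⟩
  · rw [Nat.card_coe_set_eq]
    simpa using ncard_lt_card (s := A) fun h => hx (h ▸ mem_univ x)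
  · ext y
    constructor
    · rintro ⟨i, rfl⟩
      exact ((Finite.equivFin A).symm i).2
    · intro hy
      exact ⟨Finite.equivFin A ⟨y, hy⟩,
        congrArg Subtype.val ((Finite.equivFin A).symm_apply_apply ⟨y, hy⟩)⟩

namespace Cfg3

/-- Proper induced subconfigurations of a minimum counterexample are colorable. -/
theorem MinCounterexample.colorableWith_comap {C : Cfg3} (hC : C.MinCounterexample) {m : ℕ}
    (f : Fin m ↪ Fin C.n) (hm : m < C.n) {F : Set (ℝ × ℝ)} (hF : (C.E.comap f).IsOuterFace F)
    (hCF : C.F ⊆ F) {P : List (Fin m)} {L : Fin m → Finset ℕ} (hnd : P.Nodup)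
    (hlen : P.length ≤ 2) (hface : ∀ v ∈ P, v ∈ (C.E.comap f).onFace F)
    (hchain : P.IsChain ((C.E.comap f).BoundaryEdge F))
    (hL : ∀ v ∉ P, L v = C.L (f v)) (hLP : ∀ v ∈ P, (L v).card = 1 ∧ L v ⊆ C.L (f v))
    (hP : ∀ v, f v ∈ C.P → v ∈ P)
    (hcol : ∃ φ : Fin m → ℕ, (∀ v ∈ P, φ v ∈ L v) ∧
      ∀ ⦃u v⦄, u ∈ P → v ∈ P → C.G.Adj (f u) (f v) → φ u ≠ φ v) :
    ColorableWith (C.G.comap f) L := by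
  by_contra hnot
  obtain ⟨⟨hcyc, -, -, -, -, -, hone, hsep, hin, hout, -, htwo, -⟩, -, hmin⟩ := hC
  have hon : ∀ v, f v ∈ C.E.onFace C.F → v ∈ (C.E.comap f).onFace F :=
    fun v hv => closure_mono hCF hv
  have hLsub : ∀ v, L v ⊆ C.L (f v) := fun v => by
    by_cases hv : v ∈ P
    · exact (hLP v hv).2
    · rw [hL v hv]
  let D : Cfg3 := ⟨m, C.G.comap f, C.E.comap f, F, P, L⟩
  have hD : D.Valid := by
    refine ⟨fun h => hcyc h.of_comap, hF, hnd, hlen, hface, hchain, fun v => ?_,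
      fun a b hab => ?_, fun v hv => ?_, fun v hv hvP => ?_, fun v hv => (hLP v hv).1,
      fun a b hab ha hb => ?_, hcol⟩
    · by_cases hv : v ∈ P
      · exact (hLP v hv).1.ge
      · change 1 ≤ (L v).card
        rw [hL v hv]
        exact hone _
    · exact (Finset.card_le_card (Finset.inter_subset_inter (hLsub a) (hLsub b))).trans (hsep hab)
    · change 3 ≤ (L v).card
      rw [hL v fun h => hv (hface v h)]
      exact hin _ fun h => hv (hon v h)
    · change 2 ≤ (L v).card
      rw [hL v hvP]
      by_cases h : f v ∈ C.E.onFace C.F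
      · exact hout _ h fun h' => hvP (hP v h')
      · exact (hin _ h).trans' (by norm_num)
    · change (L a).card = 2 at ha
      change (L b).card = 2 at hb
      have haP : a ∉ P := fun h => by have := (hLP a h).1; omega
      have hbP : b ∉ P := fun h => by have := (hLP b h).1; omega
      rw [hL a haP] at ha
      rw [hL b hbP] at hb
      exact htwo hab ha hb
  have hle := hmin D hD hnot
  have hE : Nat.card ↥(C.G.comap f).edgeSet ≤ Nat.card ↥C.G.edgeSet :=
    Nat.card_le_card_of_injective _
      (SimpleGraph.Embedding.mapEdgeSet (SimpleGraph.Embedding.comap f C.G)).injective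
  have hle' : C.n + Nat.card ↥C.G.edgeSet ≤ m + Nat.card ↥(C.G.comap f).edgeSet := hle
  omega

/-- Adjacency in the graph without the vertices `u` and `v`. -/
def AdjOff (C : Cfg3) (u v a b : Fin C.n) : Prop :=
  C.G.Adj a b ∧ (a ≠ u ∧ a ≠ v) ∧ b ≠ u ∧ b ≠ v

theorem AdjOff.symm {C : Cfg3} {u v a b : Fin C.n} (h : C.AdjOff u v a b) : C.AdjOff u v b a :=
  ⟨h.1.symm, h.2.2, h.2.1⟩

theorem reach_symm {C : Cfg3} {u v a b : Fin C.n}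
    (h : Relation.ReflTransGen (C.AdjOff u v) a b) : Relation.ReflTransGen (C.AdjOff u v) b a := by
  induction h with
  | refl => rfl
  | tail _ h ih => exact .head h.symm ih

/-- The ends of a chord separate the graph. -/
theorem IsChord.exists_not_reach {C : Cfg3} (hF : C.E.IsFace C.F) {u v : Fin C.n}
    (h : C.IsChord u v) : ∃ w w', (w ≠ u ∧ w ≠ v) ∧ (w' ≠ u ∧ w' ≠ v) ∧
      ¬ Relation.ReflTransGen (C.AdjOff u v) w w' := by
  obtain ⟨hadj, hu, hv, hne⟩ := h
  by_contra! hcon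
  refine hne (C.E.boundaryEdge_of_forall_eq hF hadj hu hv fun N hN => ?_)
  by_cases hex : ∃ w : Fin C.n, w ≠ u ∧ w ≠ v
  · obtain ⟨w, hw⟩ := hex
    refine ⟨N w, fun a hau hav => ?_⟩
    have hwa := hcon w a hw ⟨hau, hav⟩
    clear hau hav
    induction hwa with
    | refl => rfl
    | tail _ h ih => rw [← ih]; exact (hN _ _ h.2.1.1 h.2.1.2 h.2.2.1 h.2.2.2 h.1).symm
  · push Not at hex
    exact ⟨0, fun a hau hav => (hav (hex a hau)).elim⟩

end Cfg3

/-- **Claim 1 in the proof of Theorem 5.** In a minimum counterexample to Theorem 5,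
the outer cycle has no chord. -/
theorem min_cex_triangleFree_no_chord (C : Cfg3) (hC : C.MinCounterexample) :
    ¬ ∃ u v : Fin C.n, C.IsChord u v := by
  rintro ⟨u, v, hchord⟩
  obtain ⟨hvalid, hnot, -⟩ := id hC
  obtain ⟨-, houter, hPnd, hPlen, hPface, hPchain, -, -, -, -, hPone, -, φP, hφP, hφPadj⟩ := hvalid
  have hPreach : ∀ p ∈ C.P, ∀ q ∈ C.P, (p ≠ u ∧ p ≠ v) → (q ≠ u ∧ q ≠ v) →
      Relation.ReflTransGen (C.AdjOff u v) p q := by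
    intro p hp q hq hpuv hquv
    by_cases hpq : p = q
    · rw [hpq]
    refine .single ⟨?_, hpuv, hquv⟩
    match hPeq : C.P with
    | [] => simp [hPeq] at hp
    | [a] =>
      simp only [hPeq, List.mem_singleton] at hp hq
      exact (hpq (hp.trans hq.symm)).elim
    | [a, b] =>
      rw [hPeq] at hp hq hPchain
      have hab : C.G.Adj a b := (List.isChain_cons_cons.mp hPchain).1.1
      simp only [List.mem_cons, List.not_mem_nil, or_false] at hp hq
      rcases hp with rfl | rfl <;> rcases hq with rfl | rfl
      · exact (hpq rfl).elim
      · exact hab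
      · exact hab.symm
      · exact (hpq rfl).elim
    | a :: b :: c :: l => simp [hPeq] at hPlen
  obtain ⟨w, w', hw, hw', hww', hPw⟩ : ∃ w w' : Fin C.n, (w ≠ u ∧ w ≠ v) ∧ (w' ≠ u ∧ w' ≠ v) ∧
      ¬ Relation.ReflTransGen (C.AdjOff u v) w w' ∧
      ∀ p ∈ C.P, ¬ Relation.ReflTransGen (C.AdjOff u v) w p := by
    obtain ⟨w, w', hw, hw', h⟩ := hchord.exists_not_reach houter.1
    by_cases hP : ∀ p ∈ C.P, ¬ Relation.ReflTransGen (C.AdjOff u v) w p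
    · exact ⟨w, w', hw, hw', h, hP⟩
    · refine ⟨w', w, hw', hw, fun h' => h (Cfg3.reach_symm h'), fun q hq hwq => ?_⟩
      push Not at hP
      obtain ⟨p, hp, hwp⟩ := hP
      have hoff : ∀ x y, (x ≠ u ∧ x ≠ v) → Relation.ReflTransGen (C.AdjOff u v) x y →
          y ≠ u ∧ y ≠ v := by
        intro x y hx hxy
        rcases Relation.ReflTransGen.cases_tail hxy with rfl | ⟨z, -, hz⟩
        · exact hx
        · exact hz.2.2
      exact h ((hwp.trans (hPreach p hp q hq (hoff _ _ hw hwp) (hoff _ _ hw' hwq))).trans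
        (Cfg3.reach_symm hwq))
  set K : Set (Fin C.n) := {x | Relation.ReflTransGen (C.AdjOff u v) w x} with hK
  have hKoff : ∀ x ∈ K, x ≠ u ∧ x ≠ v := by
    intro x hx
    rcases Relation.ReflTransGen.cases_tail hx with rfl | ⟨z, -, hz⟩
    · exact hw
    · exact hz.2.2
  have hKadj : ∀ x ∈ K, ∀ y, C.G.Adj x y → y ≠ u → y ≠ v → y ∈ K := fun x hx y hxy hyu hyv =>
    Relation.ReflTransGen.tail hx ⟨hxy, hKoff x hx, hyu, hyv⟩
  have huK : u ∉ K := fun h => (hKoff u h).1 rfl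
  have hvK : v ∉ K := fun h => (hKoff v h).2 rfl
  obtain ⟨φ₁, hφ₁L, hφ₁⟩ : ∃ φ : Fin C.n → ℕ, (∀ x ∉ K, φ x ∈ C.L x) ∧
      ∀ x y, x ∉ K → y ∉ K → C.G.Adj x y → φ x ≠ φ y := by
    have hwK : w ∉ Kᶜ := fun h => h Relation.ReflTransGen.refl
    obtain ⟨m, f, hm, hf⟩ := exists_embedding_range_eq hwK
    obtain ⟨F, hF, hCF⟩ := houter.exists_comap f
    obtain ⟨P, hP⟩ : ∃ P : List (Fin m), P.map f = C.P := by
      have : C.P ∈ range (List.map f) := by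
        rw [range_list_map, hf]
        exact hPw
      exact this
    have hmem : ∀ x, f x ∈ C.P ↔ x ∈ P := fun x => by
      rw [← hP, List.mem_map_of_injective f.injective]
    obtain ⟨φ, hφL, hφ⟩ := hC.colorableWith_comap f hm hF hCF (P := P) (L := fun x => C.L (f x))
      (List.Nodup.of_map f (hP ▸ hPnd)) (by rw [← List.length_map (f := f), hP]; exact hPlen)
      (fun x hx => closure_mono hCF (hPface _ ((hmem x).mpr hx)))
      (by
        rw [← hP] at hPchain
        exact ((List.isChain_map f).mp hPchain).imp fun a b h => ⟨h.1, h.2.trans (closure_mono hCF)⟩)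
      (fun _ _ => rfl) (fun x hx => ⟨hPone _ ((hmem x).mpr hx), subset_rfl⟩)
      (fun x hx => (hmem x).mp hx)
      ⟨fun x => φP (f x), fun x hx => hφP _ ((hmem x).mpr hx), fun a b ha hb hab =>
        hφPadj ((hmem a).mpr ha) ((hmem b).mpr hb) hab⟩
    have hinv : ∀ x ∉ K, ∃ i, f i = x := fun x hx => by
      have : x ∈ range f := hf ▸ hx
      exact this
    refine ⟨Function.extend f φ 0, fun x hx => ?_, fun x y hx hy hxy => ?_⟩
    · obtain ⟨i, rfl⟩ := hinv x hx
      rw [f.injective.extend_apply]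
      exact hφL i
    · obtain ⟨i, rfl⟩ := hinv x hx
      obtain ⟨j, rfl⟩ := hinv y hy
      rw [f.injective.extend_apply, f.injective.extend_apply]
      exact hφ hxy
  obtain ⟨φ₂, hφ₂u, hφ₂v, hφ₂L, hφ₂⟩ : ∃ φ : Fin C.n → ℕ, φ u = φ₁ u ∧ φ v = φ₁ v ∧
      (∀ x ∈ K, φ x ∈ C.L x) ∧
      ∀ x y, (x ∈ K ∨ x = u ∨ x = v) → (y ∈ K ∨ y = u ∨ y = v) → C.G.Adj x y → φ x ≠ φ y := by
    have hw'A : w' ∉ {x | x ∈ K ∨ x = u ∨ x = v} := by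
      rintro (h | h | h)
      · exact hww' h
      · exact hw'.1 h
      · exact hw'.2 h
    obtain ⟨m, f, hm, hf⟩ := exists_embedding_range_eq hw'A
    obtain ⟨F, hF, hCF⟩ := houter.exists_comap f
    have hinv : ∀ x, (x ∈ K ∨ x = u ∨ x = v) → ∃ i, f i = x := fun x hx => by
      have : x ∈ range f := by rw [hf]; exact hx
      exact this
    have hfr : ∀ i, f i ∈ K ∨ f i = u ∨ f i = v := fun i => by
      have : f i ∈ {x | x ∈ K ∨ x = u ∨ x = v} := by rw [← hf]; exact ⟨i, rfl⟩
      exact this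
    obtain ⟨u', hu'⟩ := hinv u (Or.inr (Or.inl rfl))
    obtain ⟨v', hv'⟩ := hinv v (Or.inr (Or.inr rfl))
    have huface : u' ∈ (C.E.comap f).onFace F :=
      closure_mono hCF (show C.E.pos (f u') ∈ closure C.F by rw [hu']; exact hchord.2.1)
    have hvface : v' ∈ (C.E.comap f).onFace F :=
      closure_mono hCF (show C.E.pos (f v') ∈ closure C.F by rw [hv']; exact hchord.2.2.1)
    have huv' : (C.G.comap f).Adj u' v' := by
      change C.G.Adj (f u') (f v')
      rw [hu', hv']
      exact hchord.1
    have hedge : (C.E.comap f).BoundaryEdge F u' v' := by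
      refine (C.E.comap f).boundaryEdge_of_forall_eq hF.1 huv' huface hvface fun N hN => ?_
      obtain ⟨w₀, hw₀⟩ := hinv w (Or.inl Relation.ReflTransGen.refl)
      refine ⟨N w₀, ?_⟩
      have hreach : ∀ x, Relation.ReflTransGen (C.AdjOff u v) w x → ∀ a, f a = x →
          N a = N w₀ := by
        intro x hx
        induction hx with
        | refl => exact fun a ha => congrArg N (f.injective (ha.trans hw₀.symm))
        | @tail b c hb hbc ih =>
          intro a ha
          obtain ⟨b', rfl⟩ := hinv b (Or.inl hb)
          subst ha
          rw [← ih b' rfl]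
          refine (hN b' a ?_ ?_ ?_ ?_ hbc.1).symm
          · rintro rfl; exact hbc.2.1.1 hu'
          · rintro rfl; exact hbc.2.1.2 hv'
          · rintro rfl; exact hbc.2.2.1 hu'
          · rintro rfl; exact hbc.2.2.2 hv'
      intro a hau hav
      rcases hfr a with h | h | h
      · exact hreach _ h a rfl
      · exact (hau (f.injective (h.trans hu'.symm))).elim
      · exact (hav (f.injective (h.trans hv'.symm))).elim
    have hmemP : ∀ x, x ∈ [u', v'] ↔ x = u' ∨ x = v' := by simp
    have hPoff : ∀ x ∈ [u', v'], f x ∉ K := by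
      intro x hx
      rcases (hmemP x).mp hx with rfl | rfl
      · rwa [hu']
      · rwa [hv']
    obtain ⟨φ, hφL, hφ⟩ := hC.colorableWith_comap f hm hF hCF (P := [u', v'])
      (L := fun x => if x ∈ [u', v'] then {φ₁ (f x)} else C.L (f x))
      (by simpa using huv'.ne) (by simp)
      (fun x hx => by
        rcases (hmemP x).mp hx with rfl | rfl
        · exact huface
        · exact hvface)
      (List.isChain_pair.mpr hedge) (fun x hx => if_neg hx)
      (fun x hx => by
        rw [if_pos hx]
        exact ⟨Finset.card_singleton _, Finset.singleton_subset_iff.mpr (hφ₁L _ (hPoff x hx))⟩)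
      (fun x hx => by
        rcases hfr x with h | h | h
        · exact (hPw _ hx h).elim
        · exact (hmemP x).mpr (Or.inl (f.injective (h.trans hu'.symm)))
        · exact (hmemP x).mpr (Or.inr (f.injective (h.trans hv'.symm))))
      ⟨fun x => φ₁ (f x), fun x hx => by rw [if_pos hx]; exact Finset.mem_singleton_self _,
        fun a b ha hb hab => hφ₁ _ _ (hPoff a ha) (hPoff b hb) hab⟩
    refine ⟨Function.extend f φ 0, ?_, ?_, fun x hx => ?_, fun x y hx hy hxy => ?_⟩
    · have := hφL u'
      dsimp only at this
      rw [if_pos ((hmemP u').mpr (Or.inl rfl)), Finset.mem_singleton, hu'] at this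
      rw [← this, ← hu', f.injective.extend_apply]
    · have := hφL v'
      dsimp only at this
      rw [if_pos ((hmemP v').mpr (Or.inr rfl)), Finset.mem_singleton, hv'] at this
      rw [← this, ← hv', f.injective.extend_apply]
    · obtain ⟨i, rfl⟩ := hinv x (Or.inl hx)
      have := hφL i
      dsimp only at this
      rw [if_neg fun h => hPoff i h hx] at this
      rwa [f.injective.extend_apply]
    · obtain ⟨i, rfl⟩ := hinv x hx
      obtain ⟨j, rfl⟩ := hinv y hy
      rw [f.injective.extend_apply, f.injective.extend_apply]
      exact hφ hxy
  classical
  refine hnot ⟨fun x => if x ∈ K then φ₂ x else φ₁ x, fun x => ?_, ?_⟩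
  · by_cases hx : x ∈ K
    · simpa [hx] using hφ₂L x hx
    · simpa [hx] using hφ₁L x hx
  have hmixed : ∀ x ∈ K, ∀ y ∉ K, C.G.Adj x y → φ₂ x ≠ φ₁ y := by
    intro x hx y hy hxy
    have hyuv : y = u ∨ y = v := by
      by_contra! h
      exact hy (hKadj x hx y hxy h.1 h.2)
    have hyφ : φ₂ y = φ₁ y := by
      rcases hyuv with rfl | rfl
      · exact hφ₂u
      · exact hφ₂v
    rw [← hyφ]
    exact hφ₂ x y (Or.inl hx) (Or.inr hyuv) hxy
  intro x y hxy
  by_cases hx : x ∈ K <;> by_cases hy : y ∈ K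
  · simpa only [hx, hy, if_true] using hφ₂ x y (Or.inl hx) (Or.inl hy) hxy
  · simpa only [hx, hy, if_true, if_false] using hmixed x hx y hy hxy
  · simpa only [hx, hy, if_true, if_false] using (hmixed y hy x hx hxy.symm).symm
  · simpa only [hx, hy, if_false] using hφ₁ x y hx hy hxy

end ChoosSep
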